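/- For every integer n > 3, there are at least 2·n! + n distinct submonoids of cardinality (n−1)! + 1 of the monoid of all functions Z_n → Z_n under composition. -/

import Mathlib

/-- A subset of `Z_n → Z_n` which contains the identity and is closed under
composition, i.e. a submonoid of the composition monoid `Z_n^{Z_n}`. -/
def IsSubmonoidSet {n : ℕ} (S : Set (Fin n → Fin n)) : Prop :=
  (id ∈ S) ∧ ∀ f ∈ S, ∀ g ∈ S, f ∘ g ∈ S

open Finset

/-- The functions taking each `x` to a value in `V x`, together with the identity. -/
def choiceMonoid {n : ℕ} (V : Fin n → Finset (Fin n)) : Set (Fin n → Fin n) :=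
  insert id {f | ∀ x, f x ∈ V x}

/-- If `V` is transitive as a relation, then `choiceMonoid V` is a submonoid. -/
theorem isSubmonoidSet_choiceMonoid {n : ℕ} {V : Fin n → Finset (Fin n)}
    (hV : ∀ x, ∀ y ∈ V x, V y ⊆ V x) : IsSubmonoidSet (choiceMonoid V) := by
  refine ⟨Or.inl rfl, ?_⟩
  rintro f (rfl | hf) g (rfl | hg)
  · exact Or.inl rfl
  · exact Or.inr hg
  · exact Or.inr hf
  · exact Or.inr fun x => hV x _ (hg x) (hf (g x))

theorem card_choiceMonoid {n : ℕ} {V : Fin n → Finset (Fin n)} (hV : ∃ x, x ∉ V x) :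
    Nat.card (choiceMonoid V) = ∏ x, #(V x) + 1 := by
  have hpi : {f : Fin n → Fin n | ∀ x, f x ∈ V x} = ↑(Fintype.piFinset V) := by
    ext f; simp
  obtain ⟨x, hx⟩ := hV
  rw [Nat.card_coe_set_eq, choiceMonoid,
    Set.ncard_insert_of_notMem (fun h : ∀ x, id x ∈ V x => hx (h x)) (Set.toFinite _), hpi,
    Set.ncard_coe_finset, Fintype.card_piFinset]

/-- `V` can be recovered from `choiceMonoid V`. -/
theorem le_of_choiceMonoid_subset {n : ℕ} {V W : Fin n → Finset (Fin n)}
    (hne : ∀ x, (V x).Nonempty) (hV : ∃ x, x ∉ V x)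
    (h : choiceMonoid V ⊆ choiceMonoid W) (x : Fin n) : V x ⊆ W x := by
  intro y hy
  choose g hg using hne
  have hf : ∀ z, Function.update g x y z ∈ V z := by
    intro z
    rcases eq_or_ne z x with rfl | hz
    · simpa using hy
    · simpa [hz] using hg z
  rcases h (Or.inr hf) with hid | hW
  · obtain ⟨z, hz⟩ := hV
    exact absurd (by simpa [hid] using hf z) hz
  · simpa using hW x

/-- The strict order on `ℕ` with a loop added at `0`, modified at `2` when `b` holds so that the
values below `2` are `0` and `2` instead of `0` and `1`. -/
def descends (b : Bool) (a y : ℕ) : Prop :=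
  y = 0 ∨ (y < a ∧ ¬(b = true ∧ a = 2)) ∨ (b = true ∧ a = 2 ∧ y = 2)

instance (b : Bool) (a y : ℕ) : Decidable (descends b a y) := by
  unfold descends; infer_instance

theorem descends.trans {b : Bool} {a y z : ℕ} (h : descends b a y) (h' : descends b y z) :
    descends b a z := by
  unfold descends at *
  cases b <;> simp at * <;> omega

/-- The relation `descends b` on `Fin n`, relabelled by the permutation `σ`. -/
def descent {n : ℕ} (b : Bool) (σ : Equiv.Perm (Fin n)) (x : Fin n) : Finset (Fin n) :=
  {y | descends b (σ x) (σ y)}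

theorem mem_descent {n : ℕ} {b : Bool} {σ : Equiv.Perm (Fin n)} {x y : Fin n} :
    y ∈ descent b σ x ↔ descends b (σ x) (σ y) := by
  simp [descent]

theorem card_descent {n : ℕ} (hn : 0 < n) (b : Bool) (σ : Equiv.Perm (Fin n)) (x : Fin n) :
    #(descent b σ x) = max 1 (σ x : ℕ) := by
  have hinj : Function.Injective fun y => (σ y : ℕ) := Fin.val_injective.comp σ.injective
  have hx := (σ x).isLt
  have himage : (descent b σ x).image (fun y => (σ y : ℕ)) =
      if b = true ∧ (σ x : ℕ) = 2 then {0, 2} else range (max 1 (σ x : ℕ)) := by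
    ext m
    have hm : m ∈ (descent b σ x).image (fun y => (σ y : ℕ)) ↔
        m < n ∧ descends b (σ x) m := by
      simp only [mem_image, mem_descent]
      constructor
      · rintro ⟨y, hy, rfl⟩
        exact ⟨(σ y).isLt, hy⟩
      · rintro ⟨hm, h⟩
        exact ⟨σ.symm ⟨m, hm⟩, by simpa using h, by simp⟩
    rw [hm, descends]
    split_ifs with h
    · simp [h]; omega
    · simp only [mem_range]
      cases b <;> simp at * <;> omega
  rw [← card_image_of_injective _ hinj, himage]
  split_ifs with h
  · simp [h.2]
  · simp

theorem prod_card_descent {n : ℕ} (hn : 0 < n) (b : Bool) (σ : Equiv.Perm (Fin n)) :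
    ∏ x, #(descent b σ x) = (n - 1).factorial := by
  obtain ⟨n, rfl⟩ := Nat.exists_eq_succ_of_ne_zero hn.ne'
  simp_rw [card_descent hn]
  rw [Equiv.prod_comp σ (fun a => max 1 (a : ℕ)), Fin.prod_univ_eq_prod_range (fun a => max 1 a),
    prod_range_succ']
  simp [prod_range_add_one_eq_factorial]

theorem exists_notMem_descent {n : ℕ} (hn : 1 < n) (b : Bool) (σ : Equiv.Perm (Fin n)) :
    ∃ x, x ∉ descent b σ x :=
  ⟨σ.symm ⟨1, hn⟩, by simp [mem_descent, descends]⟩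

theorem descent_nonempty {n : ℕ} (b : Bool) (σ : Equiv.Perm (Fin n)) (x : Fin n) :
    (descent b σ x).Nonempty :=
  ⟨σ.symm ⟨0, x.pos⟩, by simp [mem_descent, descends]⟩

theorem descent_injective {n : ℕ} (hn : 2 < n) {b c : Bool} {σ τ : Equiv.Perm (Fin n)}
    (h : ∀ x, descent b σ x = descent c τ x) : b = c ∧ σ = τ := by
  have key : ∀ x, (σ x : ℕ) = τ x := by
    intro x
    have hcard := congrArg card (h x)
    rw [card_descent (by omega), card_descent (by omega)] at hcard
    have hmem : x ∈ descent b σ x ↔ x ∈ descent c τ x := by rw [h x]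
    simp only [mem_descent, descends] at hmem
    omega
  have hστ : σ = τ := Equiv.ext fun x => Fin.ext (key x)
  subst hστ
  have hmem : σ.symm ⟨2, hn⟩ ∈ descent b σ (σ.symm ⟨2, hn⟩) ↔
      σ.symm ⟨2, hn⟩ ∈ descent c σ (σ.symm ⟨2, hn⟩) := by rw [h]
  refine ⟨?_, rfl⟩
  cases b <;> cases c <;> simp [mem_descent, descends] at hmem ⊢

theorem eq_id_of_injective_of_mem {n : ℕ} (hn : 1 < n) {b : Bool} {σ : Equiv.Perm (Fin n)}
    {f : Fin n → Fin n} (hf : Function.Injective f) (h : f ∈ choiceMonoid (descent b σ)) :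
    f = id := by
  refine h.resolve_right fun h => ?_
  have h0 := h (σ.symm ⟨0, by omega⟩)
  have h1 := h (σ.symm ⟨1, hn⟩)
  simp only [mem_descent, descends, Equiv.apply_symm_apply] at h0 h1
  have : σ.symm ⟨0, by omega⟩ = σ.symm ⟨1, hn⟩ :=
    hf (σ.injective (Fin.ext (by omega)))
  simp at this

/-- The permutations fixing `i`, together with the constant function `i`. -/
def stabilizerWithConst {n : ℕ} (i : Fin n) : Set (Fin n → Fin n) :=
  insert (Function.const _ i) {f | Function.Bijective f ∧ f i = i}

theorem isSubmonoidSet_stabilizerWithConst {n : ℕ} (i : Fin n) :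
    IsSubmonoidSet (stabilizerWithConst i) := by
  refine ⟨Or.inr ⟨Function.bijective_id, rfl⟩, ?_⟩
  rintro f (rfl | ⟨hf, hfi⟩) g (rfl | ⟨hg, hgi⟩)
  · exact Or.inl rfl
  · exact Or.inl rfl
  · exact Or.inl (funext fun _ => hfi)
  · exact Or.inr ⟨hf.comp hg, by simp [hfi, hgi]⟩

theorem not_injective_const {n : ℕ} (hn : 1 < n) (i : Fin n) :
    ¬ Function.Injective (Function.const (Fin n) i) := by
  intro h
  have := @h ⟨0, by omega⟩ ⟨1, hn⟩ rfl
  simp at this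

theorem card_stabilizer_perm {n : ℕ} (i : Fin n) :
    Nat.card (MulAction.stabilizer (Equiv.Perm (Fin n)) i) = (n - 1).factorial := by
  have h := (MulAction.stabilizer (Equiv.Perm (Fin n)) i).card_mul_index
  rw [MulAction.index_stabilizer_of_transitive, Nat.card_perm, Nat.card_fin, mul_comm,
    ← Nat.mul_factorial_pred i.pos.ne'] at h
  exact Nat.eq_of_mul_eq_mul_left i.pos h

theorem card_stabilizerWithConst {n : ℕ} (hn : 1 < n) (i : Fin n) :
    Nat.card (stabilizerWithConst i) = (n - 1).factorial + 1 := by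
  have himage : {f : Fin n → Fin n | Function.Bijective f ∧ f i = i} =
      (fun σ : Equiv.Perm (Fin n) => (σ : Fin n → Fin n)) ''
        (MulAction.stabilizer (Equiv.Perm (Fin n)) i) := by
    ext f
    constructor
    · rintro ⟨hf, hfi⟩
      exact ⟨Equiv.ofBijective f hf, by simpa [MulAction.mem_stabilizer_iff] using hfi, rfl⟩
    · rintro ⟨σ, hσ, rfl⟩
      exact ⟨σ.bijective, hσ⟩
  rw [Nat.card_coe_set_eq, stabilizerWithConst,
    Set.ncard_insert_of_notMem (fun h => not_injective_const hn i h.1.1) (Set.toFinite _),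
    himage, Set.ncard_image_of_injective _ DFunLike.coe_injective, ← Nat.card_coe_set_eq]
  exact congrArg (· + 1) (card_stabilizer_perm i)

theorem stabilizerWithConst_injective {n : ℕ} (hn : 1 < n) :
    Function.Injective (stabilizerWithConst (n := n)) := by
  intro i j h
  have hi : Function.const _ i ∈ stabilizerWithConst j := h ▸ Or.inl rfl
  rcases hi with hi | hi
  · exact congrFun hi i
  · exact absurd hi.1.1 (not_injective_const hn i)

theorem choiceMonoid_descent_ne_stabilizerWithConst {n : ℕ} (hn : 2 < n) (b : Bool)
    (σ : Equiv.Perm (Fin n)) (i : Fin n) :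
    choiceMonoid (descent b σ) ≠ stabilizerWithConst i := by
  intro h
  obtain ⟨x, hx⟩ : ∃ x, x ∉ ({i} : Finset (Fin n)) :=
    not_forall.mp fun hall => by
      have := card_le_card (fun x _ => hall x : univ ⊆ ({i} : Finset (Fin n)))
      simp at this; omega
  obtain ⟨y, hy⟩ : ∃ y, y ∉ ({i, x} : Finset (Fin n)) :=
    not_forall.mp fun hall => by
      have := card_le_card (fun x _ => hall x : univ ⊆ ({i, x} : Finset (Fin n)))
      have := card_le_two (a := i) (b := x)
      simp at *; omega
  simp only [mem_insert, mem_singleton, not_or] at hx hy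
  have hmem : ⇑(Equiv.swap x y) ∈ stabilizerWithConst i :=
    Or.inr ⟨Equiv.bijective _, Equiv.swap_apply_of_ne_of_ne (Ne.symm hx) (Ne.symm hy.1)⟩
  rw [← h] at hmem
  have hid := eq_id_of_injective_of_mem (by omega) (Equiv.injective _) hmem
  have := congrFun hid x
  simp at this
  exact hy.2 this

/-- Proposition 3, part 2 (Submonoid sizes): for `n > 3` there are at least
`2·n! + n` distinct submonoids of cardinality `(n−1)! + 1` of the composition
monoid `Z_n^{Z_n}`. -/
theorem submonoid_sizes_part2 (n : ℕ) (hn : 3 < n) :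
    ∃ 𝒮 : Finset (Set (Fin n → Fin n)),
      2 * Nat.factorial n + n ≤ 𝒮.card ∧
      ∀ S ∈ 𝒮, IsSubmonoidSet S ∧ Nat.card S = Nat.factorial (n - 1) + 1 := by
  classical
  let F : (Bool × Equiv.Perm (Fin n)) ⊕ Fin n → Set (Fin n → Fin n) :=
    Sum.elim (fun p => choiceMonoid (descent p.1 p.2)) stabilizerWithConst
  have hF : Function.Injective F := by
    refine Function.Injective.sumElim ?_ (stabilizerWithConst_injective (by omega))
      fun p i => choiceMonoid_descent_ne_stabilizerWithConst (by omega) p.1 p.2 i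
    rintro ⟨b, σ⟩ ⟨c, τ⟩ h
    obtain ⟨hb, hσ⟩ := descent_injective (by omega) fun x => Subset.antisymm
      (le_of_choiceMonoid_subset (descent_nonempty b σ) (exists_notMem_descent (by omega) b σ)
        h.subset x)
      (le_of_choiceMonoid_subset (descent_nonempty c τ) (exists_notMem_descent (by omega) c τ)
        h.superset x)
    exact Prod.ext hb hσ
  refine ⟨univ.image F, ?_, ?_⟩
  · rw [card_image_of_injective _ hF]
    simp [Fintype.card_perm]
  · intro S hS
    obtain ⟨p | i, -, rfl⟩ := mem_image.mp hS
    · refine ⟨isSubmonoidSet_choiceMonoid fun x y hy z hz => ?_, ?_⟩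
      · rw [mem_descent] at *
        exact hy.trans hz
      · exact (card_choiceMonoid (exists_notMem_descent (by omega) p.1 p.2)).trans
          (congrArg (· + 1) (prod_card_descent (by omega) p.1 p.2))
    · exact ⟨isSubmonoidSet_stabilizerWithConst i, card_stabilizerWithConst (by omega) i⟩
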